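/- Let n be a positive integer and let f ∈ F_{2^n}[X] be a polynomial of degree d. If f is exceptional planar, then d ∈ {1, 2} or 4 divides d. -/

import Mathlib

open Polynomial

/-- A function on a field of characteristic two is planar if for every nonzero `ε`
the map `x ↦ f (x + ε) + f x + ε * x` is a bijection. -/
def IsPlanarEven {F : Type} [Field F] (f : F → F) : Prop :=
  ∀ ε : F, ε ≠ 0 → Function.Bijective (fun x : F => f (x + ε) + f x + ε * x)

/-- A polynomial over a finite field `K` of characteristic two is exceptional planar
if for infinitely many positive integers `r` it induces a planar function on the
extension of `K` of degree `r`. -/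
def IsExceptionalPlanarEven {K : Type} [Field K] [Fintype K] (f : K[X]) : Prop :=
  Set.Infinite {r : ℕ | 0 < r ∧ ∀ (L : Type) [Field L] [Fintype L] [Algebra K L],
      Fintype.card L = Fintype.card K ^ r →
      IsPlanarEven (fun x : L => Polynomial.aeval x f)}


lemma PE_pow_expand {F : Type*} [Field F] [Fintype F] (r : ℕ) (b : PowerSeries F) (N : ℕ) :
    ∃ s : PowerSeries F, b ^ (Fintype.card F ^ r) =
      (∑ n ∈ Finset.range N, PowerSeries.C (PowerSeries.coeff n b) *
        PowerSeries.X ^ (n * Fintype.card F ^ r))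
        + PowerSeries.X ^ (N * Fintype.card F ^ r) * s := by
  obtain ⟨p, hp⟩ := CharP.exists F
  obtain ⟨n, hpr, hn⟩ := FiniteField.card F p
  have : Fact p.Prime := ⟨hpr⟩
  have : CharP (PowerSeries F) p :=
    charP_of_injective_algebraMap (algebraMap F (PowerSeries F)).injective p
  have hq : Fintype.card F ^ r = p ^ (n * r : ℕ) := by rw [hn, pow_mul]
  set t : PowerSeries F := PowerSeries.mk fun i => (PowerSeries.coeff (i + N)) b
  have hb : b = PowerSeries.X ^ N * t + ∑ n ∈ Finset.range N, PowerSeries.C (PowerSeries.coeff n b) *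
        PowerSeries.X ^ n := by
    ext k
    simp only [map_add, PowerSeries.coeff_X_pow_mul', map_sum, PowerSeries.coeff_C_mul,
      PowerSeries.coeff_X_pow]
    by_cases h : N ≤ k
    · rw [if_pos h, Finset.sum_eq_zero]
      · simp [t, Nat.sub_add_cancel h]
      · intro i hi
        rw [if_neg (by have := Finset.mem_range.1 hi; omega)]; simp
    · rw [if_neg h, Finset.sum_eq_single k]
      · simp
      · intro i _ hi
        rw [if_neg (by omega)]; simp
      · intro hk; exact absurd (Finset.mem_range.2 (by omega)) hk
  refine ⟨t ^ (Fintype.card F ^ r), ?_⟩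
  conv_lhs => rw [hb]
  rw [hq, add_pow_expChar_pow, sum_pow_char_pow, add_comm, ← hq]
  congr 1
  · refine Finset.sum_congr rfl fun i _ => ?_
    rw [mul_pow, ← map_pow, FiniteField.pow_card_pow, ← pow_mul]
  · rw [mul_pow, ← pow_mul]

lemma PE_indep {F : Type*} [Field F] [Fintype F] {ι : Type*} (S : Finset ι)
    (b c : ι → PowerSeries F)
    (hb : ∀ a : ι → F, ∑ i ∈ S, PowerSeries.C (a i) * b i = 0 → ∀ i ∈ S, a i = 0)
    (hc : ∃ i ∈ S, c i ≠ 0) :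
    ∃ Q : ℕ, ∀ r : ℕ, Q ≤ Fintype.card F ^ r →
      ∑ i ∈ S, c i * b i ^ (Fintype.card F ^ r) ≠ 0 := by
  classical
  have hex : ∃ n, ∑ i ∈ S, c i * PowerSeries.C (PowerSeries.coeff n (b i)) ≠ 0 := by
    by_contra! hall
    obtain ⟨i, hi, hci⟩ := hc
    apply hci
    ext a
    refine hb (fun i => PowerSeries.coeff a (c i)) ?_ i hi
    ext n
    have := congrArg (PowerSeries.coeff a) (hall n)
    simpa [PowerSeries.coeff_C_mul, PowerSeries.coeff_mul_C] using this
  set n0 := Nat.find hex with hn0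
  have hne := Nat.find_spec hex
  have hmin : ∀ n < n0, ∑ i ∈ S, c i * PowerSeries.C (PowerSeries.coeff n (b i)) = 0 := by
    intro n hn
    have := Nat.find_min hex hn
    simpa using this
  rw [← hn0] at hne
  obtain ⟨k, hk⟩ : ∃ k, PowerSeries.coeff k
      (∑ i ∈ S, c i * PowerSeries.C (PowerSeries.coeff n0 (b i))) ≠ 0 := by
    by_contra! h
    exact hne (PowerSeries.ext (by simpa using h))
  refine ⟨k + 1, fun r hr h0 => hk ?_⟩
  set q := Fintype.card F ^ r with hq
  choose s hs using fun i => PE_pow_expand r (b i) (n0 + 1)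
  have key : ∑ i ∈ S, c i * b i ^ q = PowerSeries.X ^ (n0 * q) *
      (∑ i ∈ S, c i * PowerSeries.C (PowerSeries.coeff n0 (b i))
        + PowerSeries.X ^ q * ∑ i ∈ S, c i * s i) := by
    rw [Finset.sum_congr rfl fun i _ => by rw [hs i]]
    simp_rw [← hq, mul_add, Finset.sum_add_distrib, Finset.mul_sum]
    congr 1
    · rw [Finset.sum_comm, Finset.sum_range_succ, Finset.sum_eq_zero, zero_add]
      · exact Finset.sum_congr rfl fun i _ => by ring
      · intro n hn
        have := hmin n (Finset.mem_range.1 hn)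
        calc _ = (∑ i ∈ S, c i * PowerSeries.C (PowerSeries.coeff n (b i))) *
              PowerSeries.X ^ (n * q) := by
                rw [Finset.sum_mul]; exact Finset.sum_congr rfl fun i _ => by ring
          _ = 0 := by rw [this, zero_mul]
    · exact Finset.sum_congr rfl fun i _ => by ring
  rw [key] at h0
  rcases mul_eq_zero.1 h0 with h1 | h1
  · exact absurd h1 (pow_ne_zero _ PowerSeries.X_ne_zero)
  · have h2 := congrArg (PowerSeries.coeff k) h1
    rw [map_add, PowerSeries.coeff_X_pow_mul', if_neg (by omega)] at h2
    simpa using h2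

/-- Hensel lemma for a simple root at the origin. -/
lemma PE_hensel {F : Type*} [Field F] (P : (PowerSeries F)[X]) (b : F)
    (h0 : PowerSeries.constantCoeff (P.eval (PowerSeries.C b)) = 0)
    (h1 : PowerSeries.constantCoeff (P.derivative.eval (PowerSeries.C b)) ≠ 0) :
    ∃ y : PowerSeries F, P.eval y = 0 ∧ P.derivative.eval y ≠ 0 := by
  -- successive approximations
  have cong : ∀ (p : (PowerSeries F)[X]) (n : ℕ) (u v : PowerSeries F),
      PowerSeries.X ^ n ∣ u - v → PowerSeries.X ^ n ∣ p.eval u - p.eval v := fun p n u v h =>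
    h.trans (Polynomial.sub_dvd_eval_sub u v p)
  have step : ∀ (n : ℕ) (u : PowerSeries F), PowerSeries.X ∣ u - PowerSeries.C b →
      PowerSeries.X ^ (n+1) ∣ P.eval u →
      ∃ v : PowerSeries F, PowerSeries.X ^ (n+1) ∣ v - u ∧ PowerSeries.X ^ (n+2) ∣ P.eval v := by
    intro n u hu hPu
    obtain ⟨w, hw⟩ := hPu
    set δ := PowerSeries.constantCoeff (P.derivative.eval u) with hδ
    have hδ0 : δ ≠ 0 := by
      have := cong P.derivative 1 u (PowerSeries.C b) (by simpa using hu)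
      rw [pow_one, PowerSeries.X_dvd_iff, map_sub, sub_eq_zero] at this
      rw [hδ, this]; exact h1
    set e : F := - (PowerSeries.constantCoeff w) / δ
    refine ⟨u + PowerSeries.X ^ (n+1) * PowerSeries.C e, by simp, ?_⟩
    obtain ⟨k, hk⟩ := Polynomial.evalSubFactor P (u + PowerSeries.X ^ (n+1) * PowerSeries.C e) u |>.1 |> fun _ =>
      (⟨_, (Polynomial.binomExpansion P u (PowerSeries.X ^ (n+1) * PowerSeries.C e)).2⟩ :
        ∃ k, P.eval (u + PowerSeries.X ^ (n+1) * PowerSeries.C e) = P.eval u +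
          P.derivative.eval u * (PowerSeries.X ^ (n+1) * PowerSeries.C e) +
          k * (PowerSeries.X ^ (n+1) * PowerSeries.C e)^2)
    rw [hk, hw]
    have h3 : PowerSeries.X ∣ w + P.derivative.eval u * PowerSeries.C e := by
      rw [PowerSeries.X_dvd_iff, map_add, map_mul, ← hδ, PowerSeries.constantCoeff_C]
      simp only [e]; field_simp; ring
    obtain ⟨t, ht⟩ := h3
    refine ⟨t + k * PowerSeries.X ^ n * PowerSeries.C e ^ 2, ?_⟩
    linear_combination PowerSeries.X ^ (n+1) * ht
  let Good : ℕ → PowerSeries F → Prop := fun n u =>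
    PowerSeries.X ∣ u - PowerSeries.C b ∧ PowerSeries.X ^ (n+1) ∣ P.eval u
  have base : Good 0 (PowerSeries.C b) := ⟨by simp, by
    rw [zero_add, pow_one, PowerSeries.X_dvd_iff]; exact h0⟩
  have step' : ∀ (n : ℕ) (u : {u // Good n u}), ∃ v : {v // Good (n+1) v},
      PowerSeries.X ^ (n+1) ∣ v.1 - u.1 := by
    rintro n ⟨u, hu1, hu2⟩
    obtain ⟨v, hv1, hv2⟩ := step n u hu1 hu2
    refine ⟨⟨v, ?_, hv2⟩, hv1⟩
    have := dvd_add ((dvd_pow_self _ (Nat.succ_ne_zero n)).trans hv1) hu1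
    simpa using this
  choose nx hnx using step'
  let sq : ∀ n, {u // Good n u} := fun n => Nat.rec ⟨_, base⟩ (fun n u => nx n u) n
  have hsq : ∀ n, PowerSeries.X ^ (n+1) ∣ (sq (n+1)).1 - (sq n).1 := fun n => hnx n (sq n)
  have hsq2 : ∀ n k, PowerSeries.X ^ (n+1) ∣ (sq (n+k)).1 - (sq n).1 := by
    intro n k
    induction k with
    | zero => simp
    | succ k ih =>
      have := dvd_add ((pow_dvd_pow _ (by omega : n+1 ≤ n+k+1)).trans (hsq (n+k))) ih
      rw [sub_add_sub_cancel] at this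
      exact this
  let y : PowerSeries F := PowerSeries.mk fun n => PowerSeries.coeff n (sq n).1
  have hy : ∀ n, PowerSeries.X ^ (n+1) ∣ y - (sq n).1 := by
    intro n
    rw [PowerSeries.X_pow_dvd_iff]
    intro m hm
    obtain ⟨k, rfl⟩ := Nat.exists_eq_add_of_le (Nat.lt_succ_iff.1 hm)
    have := (PowerSeries.X_pow_dvd_iff.1 (hsq2 m k)) m (by omega)
    rw [map_sub, sub_eq_zero] at this
    simp [y, this]
  refine ⟨y, ?_, ?_⟩
  · ext n
    have := dvd_add (cong P _ _ _ (hy n)) (sq n).2.2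
    rw [sub_add_cancel] at this
    simpa using PowerSeries.X_pow_dvd_iff.1 this n (by omega)
  · intro h
    have := dvd_add (cong P.derivative 1 _ _ (by simpa using hy 0)) (cong P.derivative 1 _ _ (by simpa using (sq 0).2.1))
    rw [sub_add_sub_cancel, h, pow_one, PowerSeries.X_dvd_iff] at this
    apply h1
    simpa using this

lemma PE_aux {F R : Type*} [Field F] [CommRing R] [IsDomain R] [Algebra F R]
    (g : F[X][X]) (hg : g.Monic) (x y : R)
    (hroot : g.eval₂ (aeval x : F[X] →ₐ[F] R).toRingHom y = 0)
    (hsep : g.derivative.eval₂ (aeval x : F[X] →ₐ[F] R).toRingHom y ≠ 0)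
    (M K : ℕ) (hMK : (M - K) * g.natDegree < M) (hKM : K ≤ M) :
    ∃ c : R[X][X], c ≠ 0 ∧ (∀ l, g.natDegree ≤ l → c.coeff l = 0) ∧
      (∀ l k, K ≤ k → (c.coeff l).coeff k = 0) ∧
      ∃ A B : R[X][X], (X - C (C y)) ^ M * c =
        g.map (mapRingHom (algebraMap F R)) * A + (C (X - C x)) ^ M * B := by
  classical
  set φ : F[X] →+* R := (aeval x : F[X] →ₐ[F] R).toRingHom with hφ
  set g' : R[X][X] := g.map (mapRingHom (algebraMap F R)) with hg'
  set gx : R[X] := g.map φ with hgx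
  have hg'm : g'.Monic := hg.map _
  have hgxroot : gx.IsRoot y := by
    rw [IsRoot, hgx, eval_map]; exact hroot
  obtain ⟨h0, hh0⟩ := dvd_iff_isRoot.2 hgxroot
  have hh0y : h0.eval y ≠ 0 := by
    have : gx.derivative.eval y = h0.eval y := by rw [hh0]; simp
    rw [← this, hgx, derivative_map, eval_map]; exact hsep
  set σ : R[X][X] := C (X - C x) with hσ
  set τ : R[X][X] := X - C (C y) with hτ
  set h2 : R[X][X] := h0.map C with hh2
  obtain ⟨k, hk⟩ : σ ∣ g' - gx.map C := by
    rw [hσ, C_dvd_iff_dvd_coeff]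
    intro i
    have := X_sub_C_dvd_sub_C_eval (a := x) (p := (g.coeff i).map (algebraMap F R))
    rw [eval_map_algebraMap] at this
    simpa [hg', hgx, coeff_map, hφ] using this
  have hτh : τ * h2 = g' - σ * k := by
    rw [← hk, hh0]; simp [hτ, hh2]
  set H : R[X][X] := (h2 ^ M) %ₘ g' with hH
  have hHeq : H = h2 ^ M - g' * (h2 ^ M /ₘ g') := by
    rw [hH, modByMonic_eq_sub_mul_div]
  set m := g.natDegree with hm
  have hg'deg : g'.natDegree = m := hg.natDegree_map _
  have hHdeg : ∀ l, m ≤ l → H.coeff l = 0 := by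
    intro l hl
    apply coeff_eq_zero_of_degree_lt
    calc H.degree < g'.degree := degree_modByMonic_lt _ hg'm
      _ = (m : WithBot ℕ) := by rw [degree_eq_natDegree hg'm.ne_zero, hg'deg]
      _ ≤ l := by exact_mod_cast hl
  set s : R[X] := (X - C x) ^ M with hs
  have hsm : s.Monic := (monic_X_sub_C x).pow M
  have hsdeg : s.natDegree = M := by simp [hs]
  let κm : (Fin M → R) →ₗ[R] R[X] :=
    (degreeLT R M).subtype ∘ₗ (degreeLTEquiv R M).symm.toLinearMap
  let Φ : (Fin M → R) →ₗ[R] (Fin m × Fin (M - K) → R) :=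
    LinearMap.pi fun lk => (lcoeff R (K + lk.2)) ∘ₗ (modByMonicHom s) ∘ₗ
      (LinearMap.mulRight R (H.coeff lk.1)) ∘ₗ κm
  have hninj : ¬ Function.Injective Φ := by
    intro h
    have := card_le_of_injective R Φ h
    simp only [Fintype.card_fin, Fintype.card_prod] at this
    rw [mul_comm] at this
    omega
  obtain ⟨v, hv, hv0⟩ : ∃ v, Φ v = 0 ∧ v ≠ 0 := by
    by_contra! h
    exact hninj ((injective_iff_map_eq_zero Φ).2 h)
  set κ : R[X] := κm v with hκ
  have hκ0 : κ ≠ 0 := by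
    intro h
    apply hv0
    have : (degreeLTEquiv R M).symm v = 0 := Subtype.ext h
    simpa using this
  have hκdeg : κ.natDegree < M := by
    have h1 := ((degreeLTEquiv R M).symm v).2
    rw [mem_degreeLT] at h1
    exact (natDegree_lt_iff_degree_lt hκ0).2 h1
  have hκv : ∀ l k, l < m → K ≤ k → k < M → ((κ * H.coeff l) %ₘ s).coeff k = 0 := by
    intro l k hl hk hkM
    have := congrFun hv (⟨l, hl⟩, ⟨k - K, by omega⟩)
    have hkk : K + (k - K) = k := by omega
    simpa [Φ, modByMonicHom, hkk, hκ] using this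
  set c : R[X][X] := ∑ l ∈ Finset.range m, C ((κ * H.coeff l) %ₘ s) * X ^ l with hc
  have hcc : ∀ l, c.coeff l = if l < m then (κ * H.coeff l) %ₘ s else 0 := by
    intro l
    simp [hc, finsetSum_coeff, coeff_C_mul, coeff_X_pow]
  obtain ⟨B1, hB1⟩ : σ ^ M ∣ C κ * H - c := by
    rw [hσ, ← C_pow, C_dvd_iff_dvd_coeff]
    intro l
    rw [coeff_sub, coeff_C_mul, hcc]
    split_ifs with h
    · rw [modByMonic_eq_sub_mul_div]
      simp [hs]
    · simp [hHdeg l (by omega)]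
  let E : R[X][X] →+* R := eval₂RingHom (evalRingHom x) y
  have hEσ : E σ = 0 := by simp [E, hσ]
  have hEg : E g' = 0 := by
    simp only [E, hg', coe_eval₂RingHom, eval₂_map]
    convert hroot using 2
    ext <;> simp [hφ]
  have hEh : E h2 = h0.eval y := by
    simp only [E, hh2, coe_eval₂RingHom, eval₂_map]
    rw [eval, ]
    congr 1
    ext; simp
  refine ⟨c, ?_, ?_, ?_, ?_⟩
  · intro hc0
    rw [hc0, sub_zero] at hB1
    obtain ⟨κ', hκ', hnd⟩ := exists_eq_pow_rootMultiplicity_mul_and_not_dvd κ hκ0 x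
    set μ := rootMultiplicity x κ with hμ
    have hμM : μ < M := by
      refine lt_of_le_of_lt ?_ hκdeg
      have := natDegree_le_of_dvd (Dvd.intro _ hκ'.symm) hκ0
      simpa using this
    have h1 : σ ^ μ * (C κ' * H) = σ ^ μ * (σ ^ (M - μ) * B1) := by
      rw [← mul_assoc, ← mul_assoc, ← pow_add, Nat.add_sub_cancel' hμM.le, ← hB1, hκ', hσ]
      simp
    have hσ0 : σ ≠ 0 := by
      rw [hσ, Ne, C_eq_zero]; exact X_sub_C_ne_zero x
    have h2' := mul_left_cancel₀ (pow_ne_zero μ hσ0) h1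
    have h3 := congrArg E h2'
    rw [map_mul, map_mul, map_pow, hEσ, zero_pow (by omega), zero_mul, hHeq, map_sub, map_mul E g',
      hEg, zero_mul, sub_zero, map_pow, hEh] at h3
    rcases mul_eq_zero.1 h3 with h4 | h4
    · apply hnd
      rw [dvd_iff_isRoot, IsRoot]
      simpa [E] using h4
    · exact hh0y ((pow_eq_zero_iff (by omega)).1 h4)
  · intro l hl
    rw [hcc, if_neg (by omega)]
  · intro l k hk
    rw [hcc]
    split_ifs with h
    · by_cases hkM : k < M
      · exact hκv l k h hk hkM
      · apply coeff_eq_zero_of_degree_lt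
        calc ((κ * H.coeff l) %ₘ s).degree < s.degree := degree_modByMonic_lt _ hsm
          _ = (M : WithBot ℕ) := by rw [degree_eq_natDegree hsm.ne_zero, hsdeg]
          _ ≤ k := by exact_mod_cast (not_lt.1 hkM)
    · simp
  · obtain ⟨D, hD⟩ : g' ∣ (g' - σ * k) ^ M - (- (σ * k)) ^ M := by
      have := sub_dvd_pow_sub_pow (g' - σ * k) (-(σ * k)) M
      simpa using this
    have e1 : τ ^ M * h2 ^ M = g' * D + σ ^ M * (-k) ^ M := by
      rw [← mul_pow, hτh, ← hD, ← mul_pow]; ring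
    refine ⟨C κ * (D - τ ^ M * (h2 ^ M /ₘ g')), C κ * (-k) ^ M - τ ^ M * B1, ?_⟩
    have e2 : c = C κ * H - σ ^ M * B1 := by rw [← hB1]; ring
    rw [e2, hHeq]
    linear_combination C κ * e1

/-- `a` is represented by a polynomial of small degree. -/
def PEBd {F : Type*} [Field F] (g : F[X][X]) (n : ℕ) (a : AdjoinRoot g) : Prop :=
  ∃ p : F[X][X], AdjoinRoot.mk g p = a ∧ (∀ l, g.natDegree ≤ l → p.coeff l = 0) ∧
    ∀ l, (p.coeff l).natDegree ≤ n

lemma PEBd_exists {F : Type*} [Field F] (g : F[X][X]) (hg : g.Monic) (a : AdjoinRoot g) :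
    ∃ n, PEBd g n a := by
  obtain ⟨p, rfl⟩ := AdjoinRoot.mk_surjective a
  refine ⟨(Finset.range g.natDegree).sup fun l => ((p %ₘ g).coeff l).natDegree, p %ₘ g, ?_, ?_, ?_⟩
  · rw [AdjoinRoot.mk_eq_mk, modByMonic_eq_sub_mul_div]
    exact ⟨-(p /ₘ g), by ring⟩
  · intro l hl
    apply coeff_eq_zero_of_degree_lt
    calc (p %ₘ g).degree < g.degree := degree_modByMonic_lt _ hg
      _ = (g.natDegree : WithBot ℕ) := by rw [degree_eq_natDegree hg.ne_zero]
      _ ≤ l := by exact_mod_cast hl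
  · intro l
    by_cases hl : l < g.natDegree
    · exact Finset.le_sup (f := fun l => ((p %ₘ g).coeff l).natDegree) (Finset.mem_range.2 hl)
    · rw [coeff_eq_zero_of_degree_lt]
      · simp
      calc (p %ₘ g).degree < g.degree := degree_modByMonic_lt _ hg
        _ = (g.natDegree : WithBot ℕ) := by rw [degree_eq_natDegree hg.ne_zero]
        _ ≤ l := by exact_mod_cast (not_lt.1 hl)

lemma PEBd_mono {F : Type*} [Field F] {g : F[X][X]} {n n' : ℕ} {a : AdjoinRoot g}
    (h : PEBd g n a) (hn : n ≤ n') : PEBd g n' a := by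
  obtain ⟨p, h1, h2, h3⟩ := h
  exact ⟨p, h1, h2, fun l => (h3 l).trans hn⟩

lemma PEBd_sum {F : Type*} [Field F] {g : F[X][X]} {n : ℕ} {ι : Type*} (S : Finset ι)
    (a : ι → AdjoinRoot g) (h : ∀ i ∈ S, PEBd g n (a i)) : PEBd g n (∑ i ∈ S, a i) := by
  classical
  induction S using Finset.induction_on with
  | empty => exact ⟨0, by simp, by simp, by simp⟩
  | insert i S hi ih =>
    rw [Finset.sum_insert hi]
    obtain ⟨p, h1, h2, h3⟩ := h i (Finset.mem_insert_self _ _)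
    obtain ⟨p', h1', h2', h3'⟩ := ih fun j hj => h j (Finset.mem_insert_of_mem hj)
    refine ⟨p + p', by rw [map_add, h1, h1'], fun l hl => by rw [coeff_add, h2 l hl, h2' l hl, add_zero],
      fun l => ?_⟩
    rw [coeff_add]
    exact (natDegree_add_le _ _).trans (max_le (h3 l) (h3' l))

lemma PEBd_mulX {F : Type*} [Field F] {g : F[X][X]} {n : ℕ} {a : AdjoinRoot g}
    (h : PEBd g n a) (k : ℕ) : PEBd g (n + k) (a * (AdjoinRoot.of g X) ^ k) := by
  obtain ⟨p, h1, h2, h3⟩ := h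
  refine ⟨p * C (X ^ k), ?_, ?_, ?_⟩
  · rw [map_mul, h1, AdjoinRoot.mk_C, map_pow]
  · intro l hl
    rw [coeff_mul_C, h2 l hl, zero_mul]
  · intro l
    rw [coeff_mul_C]
    refine natDegree_mul_le.trans ?_
    have := h3 l
    simp only [natDegree_X_pow]
    omega

lemma PEBd_mulroot1 {F : Type*} [Field F] {g : F[X][X]} (hg : g.Monic) (hm : 1 ≤ g.natDegree)
    {e : ℕ} (he : ∀ l, (g.coeff l).natDegree ≤ e) {n : ℕ} {a : AdjoinRoot g}
    (h : PEBd g n a) : PEBd g (n + e) (a * AdjoinRoot.root g) := by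
  obtain ⟨p, h1, h2, h3⟩ := h
  set m := g.natDegree with hmdef
  refine ⟨p * X - C (p.coeff (m - 1)) * g, ?_, ?_, ?_⟩
  · rw [map_sub, map_mul, map_mul, AdjoinRoot.mk_self, h1, AdjoinRoot.mk_X]; ring
  · intro l hl
    obtain ⟨l', rfl⟩ : ∃ l', l = l' + 1 := ⟨l - 1, by omega⟩
    rw [coeff_sub, coeff_mul_X, coeff_C_mul]
    rcases Nat.lt_or_ge m (l' + 1) with h | h
    · rw [h2 l' (by omega), coeff_eq_zero_of_natDegree_lt (by omega : g.natDegree < l' + 1)]; simp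
    · have hl' : l' + 1 = m := by omega
      have : g.coeff (l' + 1) = 1 := by rw [hl', hmdef]; exact hg.coeff_natDegree
      rw [this, ← hl']; simp
  · intro l
    rw [coeff_sub, coeff_C_mul]
    refine (natDegree_sub_le _ _).trans (max_le ?_ ?_)
    · cases l with
      | zero => simp
      | succ l => rw [coeff_mul_X]; exact (h3 l).trans (by omega)
    · exact natDegree_mul_le.trans (add_le_add (h3 _) (he _))

lemma PEBd_mulroot {F : Type*} [Field F] {g : F[X][X]} (hg : g.Monic) (hm : 1 ≤ g.natDegree)
    {e : ℕ} (he : ∀ l, (g.coeff l).natDegree ≤ e) {n : ℕ} {a : AdjoinRoot g}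
    (h : PEBd g n a) (k : ℕ) : PEBd g (n + e * k) (a * AdjoinRoot.root g ^ k) := by
  induction k with
  | zero => simpa using h
  | succ k ih =>
    rw [pow_succ, ← mul_assoc, mul_add, mul_one, ← add_assoc]
    exact PEBd_mulroot1 hg hm he ih

lemma PE_local {F K : Type*} [Field F] [Field K] [Fintype K] [Algebra F K]
    (g : F[X][X]) (hg : g.Monic) (M : ℕ) (p B : F[X][X])
    (hp : ∀ l, g.natDegree ≤ l → p.coeff l = 0)
    (hdvd : g ∣ (X ^ Fintype.card K - X) ^ M * p - (C (X ^ Fintype.card K - X)) ^ M * B)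
    (x0 : K) (hx0 : ∀ y0 : K, g.eval₂ (aeval x0 : F[X] →ₐ[F] K).toRingHom y0 ≠ 0) (l : ℕ) :
    (X - C x0) ^ M ∣ (p.coeff l).map (algebraMap F K) := by
  classical
  set q := Fintype.card K with hq
  set ψ : F[X] →+* K[X] := mapRingHom (algebraMap F K) with hψ
  set gK : K[X][X] := g.map ψ with hgK
  have hgKm : gK.Monic := hg.map _
  have hgKdeg : gK.natDegree = g.natDegree := hg.natDegree_map _
  set g0 : K[X] := g.map (aeval x0 : F[X] →ₐ[F] K).toRingHom with hg0
  have hfac : (X ^ q - X : K[X]) = ∏ a : K, (X - C a) := by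
    have hq1 : 1 < q := Fintype.one_lt_card
    have hmon : (X ^ q - X : K[X]).Monic := monic_X_pow_sub (by rw [degree_X]; exact_mod_cast hq1)
    have := prod_multiset_X_sub_C_of_monic_of_roots_card_eq hmon (by
      rw [FiniteField.roots_X_pow_card_sub_X, FiniteField.X_pow_card_sub_X_natDegree_eq K hq1]
      rfl)
    rw [FiniteField.roots_X_pow_card_sub_X] at this
    exact this.symm
  have hcop0 : IsCoprime (X ^ q - X : K[X]) g0 := by
    rw [hfac]
    refine IsCoprime.prod_left fun a _ => ?_
    rw [(irreducible_X_sub_C a).coprime_iff_not_dvd, dvd_iff_isRoot, IsRoot, hg0, eval_map]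
    exact hx0 a
  obtain ⟨k, hk⟩ : C (X - C x0) ∣ gK - g0.map C := by
    rw [C_dvd_iff_dvd_coeff]
    intro i
    have := X_sub_C_dvd_sub_C_eval (a := x0) (p := (g.coeff i).map (algebraMap F K))
    rw [eval_map_algebraMap] at this
    simpa [hgK, hg0, coeff_map, hψ] using this
  have hcop : IsCoprime (AdjoinRoot.mk gK (X ^ q - X)) (AdjoinRoot.mk gK (C (X - C x0))) := by
    obtain ⟨a, b, hab⟩ := hcop0
    refine ⟨AdjoinRoot.mk gK (a.map C), AdjoinRoot.mk gK (- b.map C * k), ?_⟩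
    rw [← map_mul, ← map_mul, ← map_add, ← map_one (AdjoinRoot.mk gK), AdjoinRoot.mk_eq_mk]
    have h1 := congrArg (Polynomial.map (C : K →+* K[X])) hab
    simp only [Polynomial.map_add, Polynomial.map_mul, Polynomial.map_sub, Polynomial.map_pow,
      Polynomial.map_X, Polynomial.map_one] at h1
    refine ⟨- b.map C, ?_⟩
    linear_combination h1 + b.map C * hk
  have hd : gK ∣ (X ^ q - X) ^ M * p.map ψ - (C (X ^ q - X)) ^ M * B.map ψ := by
    have := Polynomial.map_dvd ψ hdvd
    simpa [hψ] using this
  have hx : (X - C x0 : K[X]) ∣ X ^ q - X := by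
    rw [hfac]; exact Finset.dvd_prod_of_mem _ (Finset.mem_univ x0)
  obtain ⟨w, hw⟩ := hx
  have h3 : (AdjoinRoot.mk gK (C (X - C x0))) ^ M ∣ AdjoinRoot.mk gK (p.map ψ) := by
    refine (hcop.symm.pow (m := M) (n := M)).dvd_of_dvd_mul_left ?_
    have h6 := AdjoinRoot.mk_eq_mk.2 hd
    rw [map_mul, map_pow (AdjoinRoot.mk gK)] at h6
    rw [h6, hw, C_mul, mul_pow, map_mul, map_mul, map_pow (AdjoinRoot.mk gK), mul_assoc]
    exact Dvd.intro _ rfl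
  obtain ⟨b', hb'⟩ := h3
  obtain ⟨b, rfl⟩ := AdjoinRoot.mk_surjective b'
  rw [← map_pow (AdjoinRoot.mk gK), ← map_mul, AdjoinRoot.mk_eq_mk] at hb'
  have h4 : p.map ψ %ₘ gK = p.map ψ := by
    rw [modByMonic_eq_self_iff hgKm]
    rw [degree_eq_natDegree hgKm.ne_zero, hgKdeg]
    rw [degree_lt_iff_coeff_zero]
    intro j hj
    rw [coeff_map, hp j hj, map_zero]
  have h5 : p.map ψ %ₘ gK = ((X - C x0) ^ M) • (b %ₘ gK) := by
    rw [← smul_modByMonic, smul_eq_C_mul, C_pow]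
    obtain ⟨z, hz⟩ := hb'
    rw [show p.map ψ = C (X - C x0) ^ M * b + gK * z by rw [← hz]; ring, add_modByMonic]
    simp [hgKm]
  rw [h4] at h5
  have := congrArg (fun p => coeff p l) h5
  simp only [coeff_map, coeff_smul, smul_eq_mul] at this
  exact ⟨_, this⟩

lemma PE_frob {F : Type*} [Field F] [Fintype F] (g : F[X][X]) (r : ℕ) :
    (g.map (mapRingHom (algebraMap F (AdjoinRoot g)))).eval₂
      (evalRingHom ((AdjoinRoot.of g X) ^ (Fintype.card F ^ r)))
      (AdjoinRoot.root g ^ (Fintype.card F ^ r)) = 0 := by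
  obtain ⟨p, hp⟩ := CharP.exists F
  obtain ⟨n, hpp, hn⟩ := FiniteField.card F p
  have : Fact p.Prime := ⟨hpp⟩
  have hcast : ((p : ℕ) : AdjoinRoot g) = 0 := by
    rw [← map_natCast (algebraMap F (AdjoinRoot g)), CharP.cast_eq_zero, map_zero]
  by_cases hnt : Nontrivial (AdjoinRoot g)
  swap
  · rw [not_nontrivial_iff_subsingleton] at hnt
    exact Subsingleton.elim _ _
  have : CharP (AdjoinRoot g) p := charP_of_injective_algebraMap (algebraMap F _).injective p
  have hq : Fintype.card F ^ r = p ^ (n * r) := by rw [hn, pow_mul]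
  have h0 : (iterateFrobenius (AdjoinRoot g) p (n * r)) (g.eval₂ (AdjoinRoot.of g) (AdjoinRoot.root g)) = 0 := by
    rw [AdjoinRoot.eval₂_root, map_zero]
  rw [hom_eval₂] at h0
  rw [eval₂_map, hq]
  rw [iterateFrobenius_def] at h0
  convert h0 using 2
  refine Polynomial.ringHom_ext ?_ ?_
  · intro a
    have : a ^ (p ^ ((n : ℕ) * r)) = a := by
      rw [← hq]; exact FiniteField.pow_card_pow r a
    simp only [RingHom.comp_apply, coe_mapRingHom, map_C, coe_evalRingHom, eval_C, iterateFrobenius_def]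
    have h2 : AdjoinRoot.of g (C a) = algebraMap F (AdjoinRoot g) a := rfl
    rw [h2, ← map_pow, this]
  · simp [iterateFrobenius_def]

lemma PE_evalExpand {R : Type*} [CommRing R] (c : R[X][X]) (K m : ℕ)
    (h1 : ∀ l, m ≤ l → c.coeff l = 0) (h2 : ∀ l k, K ≤ k → (c.coeff l).coeff k = 0) (x y : R) :
    c.eval₂ (evalRingHom x) y =
      ∑ i ∈ Finset.range K ×ˢ Finset.range m, (c.coeff i.2).coeff i.1 * x ^ i.1 * y ^ i.2 := by
  rw [Finset.sum_product_right]
  have e1 : c = ∑ l ∈ Finset.range m, C (c.coeff l) * X ^ l := by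
    ext1 l
    simp only [finsetSum_coeff, coeff_C_mul, coeff_X_pow]
    by_cases hl : l < m
    · simp [hl]
    · simp [hl, h1 l (not_lt.1 hl)]
  have e2 : ∀ l, c.coeff l = ∑ k ∈ Finset.range K, C ((c.coeff l).coeff k) * X ^ k := by
    intro l
    ext1 k
    simp only [finsetSum_coeff, coeff_C_mul, coeff_X_pow]
    by_cases hl : k < K
    · simp [hl]
    · simp [hl, h2 l k (not_lt.1 hl)]
  have e3 : ∀ l, (c.coeff l).eval x = ∑ k ∈ Finset.range K, (c.coeff l).coeff k * x ^ k := by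
    intro l
    conv_lhs => rw [e2 l]
    simp [eval_finsetSum]
  conv_lhs => rw [e1]
  simp only [eval₂_finsetSum, eval₂_mul, eval₂_C, eval₂_pow, eval₂_X, coe_evalRingHom, e3, Finset.sum_mul]

lemma PE_core {F : Type*} [Field F] [Fintype F] (g : F[X][X]) (hg : g.Monic)
    (hm : 1 ≤ g.natDegree) (y : PowerSeries F)
    (hy : g.eval₂ (coeToPowerSeries.ringHom : F[X] →+* PowerSeries F) y = 0)
    (hsep : g.derivative.eval₂ (coeToPowerSeries.ringHom : F[X] →+* PowerSeries F) y ≠ 0)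
    (hmin : ∀ p : F[X][X], (∀ l, g.natDegree ≤ l → p.coeff l = 0) →
      p.eval₂ (coeToPowerSeries.ringHom : F[X] →+* PowerSeries F) y = 0 → p = 0) :
    ∃ M n0 Q : ℕ, 1 ≤ M ∧ ∀ r : ℕ, Q ≤ Fintype.card F ^ r → ∃ p B : F[X][X], p ≠ 0 ∧
      (∀ l, g.natDegree ≤ l → p.coeff l = 0) ∧
      (∀ l, (p.coeff l).natDegree ≤ n0 + Fintype.card F ^ r * (M - 1)) ∧
      g ∣ (X ^ (Fintype.card F ^ r) - X) ^ M * p - (C (X ^ (Fintype.card F ^ r) - X)) ^ M * B := by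
  classical
  set φ := (coeToPowerSeries.ringHom : F[X] →+* PowerSeries F) with hφ
  set m := g.natDegree with hmdef
  set ι : AdjoinRoot g →+* PowerSeries F := AdjoinRoot.lift φ y hy with hι
  have hιinj : Function.Injective ι := by
    rw [injective_iff_map_eq_zero]
    intro a ha
    obtain ⟨n, p, rfl, h1, -⟩ := PEBd_exists g hg a
    rw [hι, AdjoinRoot.lift_mk] at ha
    rw [hmin p h1 ha, map_zero]
  have : IsDomain (AdjoinRoot g) := hιinj.isDomain ι
  set xR : AdjoinRoot g := AdjoinRoot.of g X with hxR
  set yR : AdjoinRoot g := AdjoinRoot.root g with hyR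
  have hae : (aeval xR : F[X] →ₐ[F] AdjoinRoot g).toRingHom = AdjoinRoot.of g := by
    refine Polynomial.ringHom_ext ?_ ?_
    · intro a
      simp only [AlgHom.toRingHom_eq_coe, RingHom.coe_coe, aeval_C]
      rfl
    · simp [hxR]
  have hιof : ∀ a, ι (AdjoinRoot.of g a) = φ a := fun a => AdjoinRoot.lift_of hy
  have hιx : ι xR = PowerSeries.X := by rw [hxR, hιof]; simp [hφ]
  have hιy : ι yR = y := AdjoinRoot.lift_root hy
  obtain ⟨e, he⟩ : ∃ e, ∀ l, (g.coeff l).natDegree ≤ e := by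
    refine ⟨(Finset.range (m + 1)).sup fun l => (g.coeff l).natDegree, fun l => ?_⟩
    by_cases hl : l < m + 1
    · exact Finset.le_sup (f := fun l => (g.coeff l).natDegree) (Finset.mem_range.2 hl)
    · rw [coeff_eq_zero_of_natDegree_lt (by omega)]; simp
  obtain ⟨m', hm'⟩ : ∃ m', m = m' + 1 := ⟨m - 1, by omega⟩
  obtain ⟨K, hK⟩ : ∃ K, K = e * m ^ 2 + 1 - e * m' := ⟨_, rfl⟩
  obtain ⟨M, hM⟩ : ∃ M, M = e * m ^ 2 + 1 := ⟨_, rfl⟩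
  have hle : e * m' ≤ e * m ^ 2 := Nat.mul_le_mul_left _ (by rw [hm']; nlinarith)
  have hMK : M = K + e * m' := by omega
  have hK1 : 1 ≤ K := by omega
  obtain ⟨c, hc0, hc1, hc2, A, B, hAB⟩ := PE_aux g hg xR yR
    (by rw [hae]; exact AdjoinRoot.eval₂_root g)
    (by
      rw [hae]
      intro h
      apply hsep
      have := congrArg ι h
      rw [map_zero, hom_eval₂, hιy] at this
      convert this using 2
      exact RingHom.ext fun a => (hιof a).symm) M K
    (by
      rw [hMK, Nat.add_sub_cancel_left, ← hmdef, ← hMK, hM, hm']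
      nlinarith [Nat.zero_le (e * m'), Nat.zero_le e]) (by omega)
  set S := Finset.range K ×ˢ Finset.range m with hS
  -- uniform degree bound for the coefficients
  choose nn hnn using fun i : ℕ × ℕ => PEBd_exists g hg ((c.coeff i.2).coeff i.1)
  set n0 := S.sup nn with hn0
  obtain ⟨Q, hQ⟩ := PE_indep S (fun i => PowerSeries.X ^ i.1 * y ^ i.2)
    (fun i => ι ((c.coeff i.2).coeff i.1))
    (by
      intro a ha
      set p : F[X][X] := ∑ i ∈ S, C (C (a i) * X ^ i.1) * X ^ i.2 with hp
      have hpc : ∀ l, p.coeff l = ∑ i ∈ S, if l = i.2 then C (a i) * X ^ i.1 else 0 := by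
        intro l
        simp only [hp, finsetSum_coeff, coeff_C_mul, coeff_X_pow, mul_ite, mul_one, mul_zero]
      have hp0 : p = 0 := by
        apply hmin
        · intro l hl
          rw [hpc]
          refine Finset.sum_eq_zero fun i hi => ?_
          rw [if_neg]
          rw [hS, Finset.mem_product, Finset.mem_range, Finset.mem_range] at hi
          omega
        · rw [hp, eval₂_finsetSum, ← ha]
          refine Finset.sum_congr rfl fun i _ => ?_
          rw [eval₂_mul, eval₂_C, eval₂_X_pow, map_mul, map_pow, mul_assoc, hφ]
          simp
      intro i hi
      have h1 := hpc i.2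
      rw [hp0, coeff_zero] at h1
      have h2 := congrArg (fun t => coeff t i.1) h1
      simp only [finsetSum_coeff, coeff_zero] at h2
      rw [Finset.sum_eq_single i] at h2
      · simpa using h2.symm
      · intro j _ hji
        split_ifs with hh
        · rw [coeff_C_mul, coeff_X_pow, if_neg, mul_zero]
          intro h3
          exact hji (Prod.ext h3.symm hh.symm)
        · simp
      · exact fun h => absurd hi h)
    (by
      by_contra! hall
      apply hc0
      ext1 l
      ext1 k
      rw [coeff_zero, coeff_zero]
      by_cases hl : m ≤ l
      · rw [hc1 l hl, coeff_zero]
      by_cases hk : K ≤ k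
      · exact hc2 l k hk
      have := hall (k, l) (by rw [hS, Finset.mem_product, Finset.mem_range, Finset.mem_range]; omega)
      exact hιinj (by rw [map_zero]; exact this))
  refine ⟨M, n0, Q, by omega, fun r hr => ?_⟩
  have hfrob := PE_frob g r
  set q := Fintype.card F ^ r with hq
  set E : (AdjoinRoot g)[X][X] →+* AdjoinRoot g := eval₂RingHom (evalRingHom (xR ^ q)) (yR ^ q) with hE
  have hE1 := congrArg E hAB
  have hEg : E (g.map (mapRingHom (algebraMap F (AdjoinRoot g)))) = 0 := hfrob
  rw [map_add, map_mul, map_mul E (g.map _), hEg, zero_mul, zero_add, map_mul, map_pow, map_pow] at hE1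
  have hEX : E (X - C (C yR)) = yR ^ q - yR := by simp [hE]
  have hEx : E (C (X - C xR)) = xR ^ q - xR := by simp [hE]
  rw [hEX, hEx] at hE1
  have hEc : E c = ∑ i ∈ S, (c.coeff i.2).coeff i.1 * (xR ^ q) ^ i.1 * (yR ^ q) ^ i.2 :=
    PE_evalExpand c K m hc1 hc2 _ _
  have hEc0 : E c ≠ 0 := by
    intro h
    apply hQ r hr
    have := congrArg ι (hEc.symm.trans h)
    rw [map_zero, map_sum] at this
    rw [← this]
    refine Finset.sum_congr rfl fun i _ => ?_
    simp only [map_mul, map_pow, hιx, hιy]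
    rw [← hq]
    ring
  have hbd : PEBd g (n0 + q * (M - 1)) (E c) := by
    rw [hEc]
    refine PEBd_sum _ _ fun i hi => ?_
    have h1 : PEBd g n0 ((c.coeff i.2).coeff i.1) := PEBd_mono (hnn i) (Finset.le_sup hi)
    have h2 := PEBd_mulroot hg hm he (PEBd_mulX h1 (q * i.1)) (q * i.2)
    rw [← pow_mul, ← pow_mul]
    refine PEBd_mono h2 ?_
    rw [hS, Finset.mem_product, Finset.mem_range, Finset.mem_range] at hi
    have h3 : i.1 + e * i.2 ≤ M - 1 := by
      have : e * i.2 ≤ e * m' := Nat.mul_le_mul_left _ (by omega)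
      omega
    have h4 := Nat.mul_le_mul_left q h3
    calc n0 + q * i.1 + e * (q * i.2) = n0 + q * (i.1 + e * i.2) := by ring
      _ ≤ _ := by omega
  obtain ⟨p, hp1, hp2, hp3⟩ := hbd
  obtain ⟨B', hB'⟩ := AdjoinRoot.mk_surjective (E B)
  refine ⟨p, B', ?_, hp2, hp3, ?_⟩
  · rintro rfl
    exact hEc0 (by rw [← hp1, map_zero])
  · rw [← AdjoinRoot.mk_eq_mk, map_mul, map_mul, map_pow (AdjoinRoot.mk g), map_pow (AdjoinRoot.mk g),
      hp1, hB', AdjoinRoot.mk_C, map_sub, map_sub, map_pow, map_pow, AdjoinRoot.mk_X]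
    exact hE1

lemma PE_count {F : Type*} [Field F] [Fintype F] (g : F[X][X]) (hg : g.Monic)
    (hm : 1 ≤ g.natDegree) (y : PowerSeries F)
    (hy : g.eval₂ (coeToPowerSeries.ringHom : F[X] →+* PowerSeries F) y = 0)
    (hsep : g.derivative.eval₂ (coeToPowerSeries.ringHom : F[X] →+* PowerSeries F) y ≠ 0)
    (hmin : ∀ p : F[X][X], (∀ l, g.natDegree ≤ l → p.coeff l = 0) →
      p.eval₂ (coeToPowerSeries.ringHom : F[X] →+* PowerSeries F) y = 0 → p = 0) (C0 : ℕ) :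
    ∃ N0 : ℕ, ∀ (K : Type) [Field K] [Fintype K] [Algebra F K] (r : ℕ),
      Fintype.card K = Fintype.card F ^ r → N0 ≤ Fintype.card K →
      ∀ T : Finset K, T.card ≤ C0 → ∃ x0, x0 ∉ T ∧
        ∃ y0 : K, g.eval₂ (aeval x0 : F[X] →ₐ[F] K).toRingHom y0 = 0 := by
  classical
  obtain ⟨M, n0, Q, hM, hcore⟩ := PE_core g hg hm y hy hsep hmin
  refine ⟨max Q (n0 + M * C0 + 1), fun K _ _ _ r hcard hN T hT => ?_⟩
  by_contra! hcon
  obtain ⟨p, B, hp0, hp1, hp2, hdvd⟩ := hcore r (hcard ▸ (le_max_left _ _).trans hN)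
  rw [← hcard] at hp2 hdvd
  obtain ⟨l, hl⟩ : ∃ l, p.coeff l ≠ 0 := by
    by_contra! h
    exact hp0 (Polynomial.ext fun l => by rw [h l, coeff_zero])
  have hloc : ∀ x0 ∈ Tᶜ, (X - C x0) ^ M ∣ (p.coeff l).map (algebraMap F K) := fun x0 hx0 =>
    PE_local g hg M p B hp1 hdvd x0 (hcon x0 (Finset.mem_compl.1 hx0)) l
  have hprod : ∏ x0 ∈ Tᶜ, (X - C x0) ^ M ∣ (p.coeff l).map (algebraMap F K) := by
    refine Finset.prod_dvd_of_coprime ?_ hloc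
    intro a _ b _ hab
    exact (isCoprime_X_sub_C_of_isUnit_sub (sub_ne_zero.2 hab).isUnit).pow
  have hne : (p.coeff l).map (algebraMap F K) ≠ 0 :=
    (Polynomial.map_ne_zero_iff (algebraMap F K).injective).2 hl
  have hdeg := natDegree_le_of_dvd hprod hne
  rw [natDegree_map, natDegree_prod_of_monic _ _ (fun a _ => (monic_X_sub_C a).pow M)] at hdeg
  simp only [natDegree_pow, natDegree_X_sub_C, mul_one, Finset.sum_const, smul_eq_mul] at hdeg
  have h1 := hdeg.trans (hp2 l)
  have h2 : Tᶜ.card + T.card = Fintype.card K := Finset.card_compl_add_card T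
  have h3 : n0 + M * C0 + 1 ≤ Fintype.card K := (le_max_right _ _).trans hN
  obtain ⟨M', rfl⟩ : ∃ M', M = M' + 1 := ⟨M - 1, by omega⟩
  rw [Nat.add_sub_cancel] at h1
  have h4 : T.card * (M' + 1) ≤ C0 * (M' + 1) := Nat.mul_le_mul_right _ hT
  have h5 : Fintype.card K * (M' + 1) = Tᶜ.card * (M' + 1) + T.card * (M' + 1) := by
    rw [← h2]; ring
  have h6 : Fintype.card K * (M' + 1) = Fintype.card K * M' + Fintype.card K := by ring
  have h7 : C0 * (M' + 1) = (M' + 1) * C0 := mul_comm _ _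
  omega

lemma PE_monic {F : Type*} [Field F] [Fintype F] (P : F[X][X]) (hP : P.Monic) (b : F)
    (h0 : (P.eval (C b)).eval 0 = 0) (h1 : (P.derivative.eval (C b)).eval 0 ≠ 0) (C0 : ℕ) :
    ∃ N0 : ℕ, ∀ (K : Type) [Field K] [Fintype K] [Algebra F K] (r : ℕ),
      Fintype.card K = Fintype.card F ^ r → N0 ≤ Fintype.card K →
      ∀ T : Finset K, T.card ≤ C0 → ∃ x0, x0 ∉ T ∧
        ∃ y0 : K, P.eval₂ (aeval x0 : F[X] →ₐ[F] K).toRingHom y0 = 0 := by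
  set φ := (coeToPowerSeries.ringHom : F[X] →+* PowerSeries F) with hφ
  have hφinj : Function.Injective φ := Polynomial.coe_injective F
  have key : ∀ p : F[X][X], PowerSeries.constantCoeff ((p.map φ).eval (PowerSeries.C b)) =
      (p.eval (C b)).eval 0 := by
    intro p
    have : PowerSeries.C b = φ (C b) := by simp [hφ]
    rw [this, eval_map, eval₂_at_apply]
    simp [hφ, coeff_zero_eq_eval_zero]
  obtain ⟨y, hy, hy'⟩ := PE_hensel (P.map φ) b (by rw [key, h0]) (by rwa [derivative_map, key])
  rw [derivative_map, eval_map] at hy'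
  rw [eval_map] at hy
  let : Algebra F[X] (PowerSeries F) := φ.toAlgebra
  have hmap : algebraMap F[X] (PowerSeries F) = φ := rfl
  have : Module.IsTorsionFree F[X] (PowerSeries F) := by
    rw [Module.isTorsionFree_iff_algebraMap_injective]
    exact hφinj
  have hyInt : IsIntegral F[X] y := ⟨P, hP, hy⟩
  set g := minpoly F[X] y with hgdef
  have hgm : g.Monic := minpoly.monic hyInt
  have hgP : g ∣ P := minpoly.isIntegrallyClosed_dvd hyInt (by rw [aeval_def]; exact hy)
  obtain ⟨Q, hQ⟩ := hgP
  have hgy : g.eval₂ φ y = 0 := minpoly.aeval F[X] y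
  have hgm1 : 1 ≤ g.natDegree := minpoly.natDegree_pos hyInt
  obtain ⟨N0, hN0⟩ := PE_count g hgm hgm1 y hgy
    (by
      intro h
      apply hy'
      rw [hQ, derivative_mul, eval₂_add, eval₂_mul, eval₂_mul]
      rw [hφ, h, ← hφ, hgy]; ring)
    (by
      intro p hp hpy
      by_contra hne
      have h2 : g ∣ p := minpoly.isIntegrallyClosed_dvd hyInt (by rw [aeval_def]; exact hpy)
      have h3 := natDegree_le_of_dvd h2 hne
      exact hne (leadingCoeff_eq_zero.1 (hp _ h3))) C0
  refine ⟨N0, fun K _ _ _ r hcard hN T hT => ?_⟩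
  obtain ⟨x0, hx0, y0, hy0⟩ := hN0 K r hcard hN T hT
  exact ⟨x0, hx0, y0, by rw [hQ, eval₂_mul, hy0, zero_mul]⟩

lemma PE_eval_eval {F : Type*} [Field F] (p : F[X][X]) (s : F[X]) :
    (p.eval s).eval 0 = (p.eval (C (s.eval 0))).eval 0 := by
  have h : ∀ s : F[X], (p.eval s).eval 0 = (p.map (evalRingHom 0)).eval (s.eval 0) := by
    intro s
    rw [eval_map]
    have := eval₂_at_apply (p := p) (evalRingHom (0 : F)) s
    simpa using this.symm
  rw [h, h]; simp

lemma PE_nonmonic {F : Type*} [Field F] [Fintype F] (P : F[X][X]) (hn : 1 ≤ P.natDegree)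
    (hlc : P.leadingCoeff.eval 0 ≠ 0) (b : F)
    (h0 : (P.eval (C b)).eval 0 = 0) (h1 : (P.derivative.eval (C b)).eval 0 ≠ 0) (C0 : ℕ) :
    ∃ N0 : ℕ, ∀ (K : Type) [Field K] [Fintype K] [Algebra F K] (r : ℕ),
      Fintype.card K = Fintype.card F ^ r → N0 ≤ Fintype.card K →
      ∀ T : Finset K, T.card ≤ C0 → ∃ x0, x0 ∉ T ∧
        ∃ y0 : K, P.eval₂ (aeval x0 : F[X] →ₐ[F] K).toRingHom y0 = 0 := by
  classical
  have hP0 : P ≠ 0 := by rintro rfl; simp at hn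
  set N := integralNormalization P with hN
  have hcomp : N.comp (C P.leadingCoeff * X) = C P.leadingCoeff ^ (P.natDegree - 1) * P := by
    have := integralNormalization_eval₂_leadingCoeff_mul hn (C : F[X] →+* F[X][X]) X
    rwa [eval₂_C_X] at this
  have e0 := congrArg (fun t => (eval (C b) t).eval 0) hcomp
  have e1 := congrArg (fun t => (eval (C b) (derivative t)).eval 0) hcomp
  simp only [eval_comp, eval_mul, eval_C, eval_X, eval_pow, h0, mul_zero] at e0
  rw [PE_eval_eval] at e0
  rw [derivative_comp, ← C_pow, derivative_C_mul, derivative_C_mul, derivative_X] at e1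
  simp only [eval_comp, eval_mul, eval_C, eval_X, eval_pow, mul_one] at e1
  rw [PE_eval_eval N.derivative] at e1
  obtain ⟨N0, hN0⟩ := PE_monic N (monic_integralNormalization hP0) _ e0 (by
    intro h
    rw [h, mul_zero] at e1
    exact mul_ne_zero (pow_ne_zero _ hlc) h1 e1.symm) (C0 + P.leadingCoeff.natDegree)
  refine ⟨N0, fun K _ _ _ r hcard hNN T hT => ?_⟩
  have hl0 : P.leadingCoeff ≠ 0 := leadingCoeff_ne_zero.2 hP0
  obtain ⟨x0, hx0, w0, hw0⟩ := hN0 K r hcard hNN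
    (T ∪ (P.leadingCoeff.map (algebraMap F K)).roots.toFinset) (by
      refine (Finset.card_union_le _ _).trans (add_le_add hT ?_)
      refine (Multiset.toFinset_card_le _).trans ((card_roots' _).trans ?_)
      rw [natDegree_map])
  rw [Finset.mem_union, not_or] at hx0
  have hne : (aeval x0 : F[X] →ₐ[F] K).toRingHom P.leadingCoeff ≠ 0 := by
    intro h
    apply hx0.2
    rw [Multiset.mem_toFinset, mem_roots ((Polynomial.map_ne_zero_iff (algebraMap F K).injective).2 hl0),
      IsRoot, eval_map_algebraMap]
    exact h
  refine ⟨x0, hx0.1, w0 / (aeval x0 : F[X] →ₐ[F] K).toRingHom P.leadingCoeff, ?_⟩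
  have h2 := integralNormalization_eval₂_leadingCoeff_mul hn (aeval x0 : F[X] →ₐ[F] K).toRingHom
    (w0 / (aeval x0 : F[X] →ₐ[F] K).toRingHom P.leadingCoeff)
  rw [mul_div_cancel₀ _ hne, ← hN, hw0] at h2
  exact (mul_eq_zero.1 h2.symm).resolve_left (pow_ne_zero _ hne)

/-- The polynomial `((1 + X) ^ i - X ^ i - 1) / X` for positive `i`, and `0` for `i = 0`. -/
noncomputable def PEq (F : Type*) [Field F] (i : ℕ) : F[X] := divX ((1 + X) ^ i - X ^ i)

lemma PEq_coeff (F : Type*) [Field F] (i t : ℕ) :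
    (PEq F i).coeff t = (i.choose (t + 1) : F) - if t + 1 = i then 1 else 0 := by
  rw [PEq, coeff_divX, coeff_sub, coeff_one_add_X_pow, coeff_X_pow]

lemma PEq_coeff_zero (F : Type*) [Field F] (i t : ℕ) (h : i ≤ t + 1) : (PEq F i).coeff t = 0 := by
  rw [PEq_coeff]
  rcases h.eq_or_lt with h | h
  · rw [if_pos h.symm, h]; simp
  · rw [if_neg (by omega), Nat.choose_eq_zero_of_lt h]; simp

lemma PEq_mul_X (F : Type*) [Field F] (i : ℕ) :
    PEq F i * X = (1 + X) ^ i - X ^ i - if i = 0 then 0 else 1 := by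
  have h := divX_mul_X_add ((1 + X : F[X]) ^ i - X ^ i)
  have h2 : C (((1 + X : F[X]) ^ i - X ^ i).coeff 0) = if i = 0 then 0 else 1 := by
    rw [coeff_sub, coeff_one_add_X_pow, coeff_X_pow]
    by_cases hi : i = 0
    · simp [hi]
    · rw [if_neg hi, if_neg (Ne.symm hi)]; simp
  rw [h2] at h
  rw [PEq]; exact eq_sub_of_add_eq h

/-- The auxiliary plane curve attached to `f`. -/
noncomputable def PEP {F : Type*} [Field F] (f : F[X]) (d : ℕ) : F[X][X] :=
  ∑ i ∈ Finset.range (d + 1), C (C (f.coeff i) * X ^ (d - i)) * (PEq F i).map C + C (X ^ (d - 2))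

lemma PEP_coeff {F : Type*} [Field F] (f : F[X]) (d t : ℕ) :
    (PEP f d).coeff t = ∑ i ∈ Finset.range (d + 1),
      C (f.coeff i) * X ^ (d - i) * C ((PEq F i).coeff t) + if t = 0 then X ^ (d - 2) else 0 := by
  rw [PEP, coeff_add, finsetSum_coeff, coeff_C]
  simp only [coeff_C_mul, coeff_map]

lemma PEP_map {F : Type*} [Field F] (f : F[X]) (d : ℕ) (hd : 3 ≤ d) :
    (PEP f d).map (evalRingHom 0) = C (f.coeff d) * PEq F d := by
  ext t
  rw [coeff_map, PEP_coeff, coeff_C_mul, coe_evalRingHom, eval_add, eval_finsetSum,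
    Finset.sum_eq_single d]
  · by_cases ht : t = 0
    · simp [ht, show d - 2 ≠ 0 by omega]
    · simp [ht]
  · intro i hi hid
    rw [Finset.mem_range] at hi
    simp [show d - i ≠ 0 by omega]
  · simp

lemma PEP_coeff_zero {F : Type*} [Field F] (f : F[X]) (d t : ℕ) (hd : 3 ≤ d) (h : d ≤ t + 1) :
    (PEP f d).coeff t = 0 := by
  rw [PEP_coeff, if_neg (by omega), add_zero]
  refine Finset.sum_eq_zero fun i hi => ?_
  rw [Finset.mem_range] at hi
  rw [PEq_coeff_zero F i t (by omega)]; simp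

lemma PEP_coeff_pred {F : Type*} [Field F] (f : F[X]) (d t : ℕ) (hd : 3 ≤ d) (h : d = t + 2) :
    (PEP f d).coeff t = C (f.coeff d * d) := by
  rw [PEP_coeff, if_neg (by omega), add_zero, Finset.sum_eq_single d]
  · have hc : d.choose (t + 1) = d := by rw [h, Nat.choose_succ_self_right]
    rw [PEq_coeff, if_neg (by omega), hc]
    simp
  · intro i hi hid
    rw [Finset.mem_range] at hi
    rw [PEq_coeff_zero F i t (by omega)]; simp
  · simp

lemma PEP_coeff0_ne {F : Type*} [Field F] (h2 : (2 : F) = 0) (f : F[X]) (d : ℕ) (hd : 3 ≤ d) :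
    (PEP f d).coeff 0 ≠ 0 := by
  intro h
  have h1 := congrArg (fun p => coeff p (d - 2)) h
  rw [PEP_coeff] at h1
  simp only [if_true, coeff_add, finsetSum_coeff, coeff_mul_C, coeff_C_mul, coeff_X_pow, coeff_zero] at h1
  rw [Finset.sum_eq_zero] at h1
  · simp at h1
  · intro i hi
    rw [Finset.mem_range] at hi
    by_cases hi2 : i = 2
    · subst hi2
      rw [PEq_coeff]; simp [h2]
    · rw [if_neg (by omega)]; simp

lemma PEP_eval {F K : Type*} [Field F] [Field K] [Algebra F K] (f : F[X]) (d : ℕ)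
    (hdeg : f.natDegree = d) (hd : 3 ≤ d) (x V : K) (hx : x ≠ 0)
    (h : (PEP f d).eval₂ (aeval x : F[X] →ₐ[F] K).toRingHom V = 0) :
    aeval (x⁻¹ + x⁻¹ * V) f - aeval (x⁻¹ * V) f - aeval x⁻¹ f + aeval 0 f + x⁻¹ * (x⁻¹ * V) = 0 := by
  have hexp : ∀ z : K, aeval z f = ∑ i ∈ Finset.range (d + 1), algebraMap F K (f.coeff i) * z ^ i := by
    intro z
    rw [aeval_eq_sum_range, hdeg]
    simp only [Algebra.smul_def]
  have hC : ((aeval x : F[X] →ₐ[F] K).toRingHom).comp C = algebraMap F K := by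
    ext a; simp
  have hq : ∀ i, ((PEq F i).map C).eval₂ (aeval x : F[X] →ₐ[F] K).toRingHom V * V =
      (1 + V) ^ i - V ^ i - if i = 0 then 0 else 1 := by
    intro i
    rw [eval₂_map, hC]
    have := congrArg (eval₂ (algebraMap F K) V) (PEq_mul_X F i)
    rw [eval₂_mul, eval₂_X] at this
    rw [this]
    split_ifs <;> simp
  have h1 : (PEP f d).eval₂ (aeval x : F[X] →ₐ[F] K).toRingHom V * V * x⁻¹ ^ d = 0 := by
    rw [h]; ring
  rw [PEP, eval₂_add, eval₂_finsetSum, add_mul, add_mul, Finset.sum_mul, Finset.sum_mul] at h1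
  rw [hexp, hexp, hexp, hexp, ← Finset.sum_sub_distrib, ← Finset.sum_sub_distrib,
    ← Finset.sum_add_distrib]
  refine Eq.trans ?_ h1
  congr 1
  · refine Finset.sum_congr rfl fun i hi => ?_
    rw [Finset.mem_range] at hi
    rw [eval₂_mul, eval₂_C, mul_assoc _ _ V, hq]
    have e1 : (aeval x : F[X] →ₐ[F] K).toRingHom (C (f.coeff i) * X ^ (d - i)) =
        algebraMap F K (f.coeff i) * x ^ (d - i) := by simp
    have e2 : x⁻¹ ^ d = x⁻¹ ^ (d - i) * x⁻¹ ^ i := by rw [← pow_add]; congr 1; omega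
    have e3 : x ^ (d - i) * x⁻¹ ^ (d - i) = 1 := by rw [← mul_pow, mul_inv_cancel₀ hx, one_pow]
    have e4 : (x⁻¹ + x⁻¹ * V) ^ i = x⁻¹ ^ i * (1 + V) ^ i := by rw [← mul_pow]; ring
    rw [e1, e2, e4, mul_pow]
    by_cases hi0 : i = 0
    · subst hi0; simp
    · rw [if_neg hi0, zero_pow hi0]
      linear_combination (-(algebraMap F K (f.coeff i)) * x⁻¹ ^ i * ((1 + V) ^ i - V ^ i - 1)) * e3
  · rw [eval₂_C]
    have e1 : (aeval x : F[X] →ₐ[F] K).toRingHom (X ^ (d - 2)) = x ^ (d - 2) := by simp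
    have e2 : x⁻¹ ^ d = x⁻¹ ^ (d - 2) * x⁻¹ ^ 2 := by rw [← pow_add]; congr 1; omega
    have e3 : x ^ (d - 2) * x⁻¹ ^ (d - 2) = 1 := by rw [← mul_pow, mul_inv_cancel₀ hx, one_pow]
    rw [e1, e2]
    linear_combination (-V * x⁻¹ ^ 2) * e3

lemma PE_final (K : Type) [Field K] [Fintype K] [CharP K 2] (f : K[X]) (d : ℕ)
    (hdeg : f.natDegree = d) (hd : 3 ≤ d) (hexc : IsExceptionalPlanarEven f)
    (m : ℕ) (hm : 1 ≤ m) (hlow : ∀ t, m < t → (PEP f d).coeff t = 0)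
    (hlc : ((PEP f d).coeff m).eval 0 ≠ 0) (b : K)
    (h0 : (PEq K d).eval b = 0) (h1 : (PEq K d).derivative.eval b ≠ 0) : False := by
  classical
  have h2 : (2 : K) = 0 := CharTwo.two_eq_zero
  have had : f.coeff d ≠ 0 := by
    have : f ≠ 0 := by rintro rfl; simp at hdeg; omega
    rw [← hdeg]
    exact leadingCoeff_ne_zero.2 this
  have hnat : (PEP f d).natDegree = m := by
    refine natDegree_eq_of_le_of_coeff_ne_zero (natDegree_le_iff_coeff_eq_zero.2 hlow) ?_
    intro h
    rw [h] at hlc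
    simp at hlc
  have hev : ∀ p : K[X][X], (p.eval (C b)).eval 0 = (p.map (evalRingHom 0)).eval b := by
    intro p
    rw [eval_map]
    have := eval₂_at_apply (p := p) (evalRingHom (0 : K)) (C b)
    simpa using this.symm
  obtain ⟨N0, hN0⟩ := PE_nonmonic (PEP f d) (by omega) (by rw [leadingCoeff, hnat]; exact hlc) b
    (by rw [hev, PEP_map f d hd, eval_mul, h0, mul_zero])
    (by
      rw [hev, ← derivative_map, PEP_map f d hd, derivative_C_mul, eval_mul, eval_C]
      exact mul_ne_zero had h1) (1 + ((PEP f d).coeff 0).natDegree)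
  obtain ⟨r, ⟨hr0, hr⟩, hrN⟩ := Set.Infinite.exists_gt hexc N0
  have : NeZero r := ⟨hr0.ne'⟩
  have : Fact (Nat.Prime 2) := ⟨Nat.prime_two⟩
  let L := FiniteField.Extension K 2 r
  let : Fintype L := Fintype.ofFinite L
  have hcard : Fintype.card L = Fintype.card K ^ r := by
    rw [← Nat.card_eq_fintype_card, ← Nat.card_eq_fintype_card]
    exact FiniteField.natCard_extension K 2 r
  have hplan := hr L hcard
  have hbig : N0 ≤ Fintype.card L := by
    rw [hcard]
    have := Nat.lt_pow_self (n := r) (Fintype.one_lt_card (α := K))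
    omega
  have hL2 : (2 : L) = 0 := by
    have := congrArg (algebraMap K L) h2
    rwa [map_ofNat, map_zero] at this
  set c0 := (PEP f d).coeff 0 with hc0
  have hc0ne : c0.map (algebraMap K L) ≠ 0 :=
    (Polynomial.map_ne_zero_iff (algebraMap K L).injective).2 (PEP_coeff0_ne h2 f d hd)
  obtain ⟨x, hxT, V, hV⟩ := hN0 L r hcard hbig (insert 0 (c0.map (algebraMap K L)).roots.toFinset) (by
    refine (Finset.card_insert_le _ _).trans ?_
    rw [add_comm]
    refine add_le_add le_rfl ((Multiset.toFinset_card_le _).trans ((card_roots' _).trans ?_))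
    rw [natDegree_map])
  rw [Finset.mem_insert, not_or] at hxT
  have hx := hxT.1
  have hV0 : V ≠ 0 := by
    rintro rfl
    apply hxT.2
    rw [Multiset.mem_toFinset, mem_roots hc0ne, IsRoot, eval_map_algebraMap, hc0]
    rw [eval₂_at_zero] at hV
    exact hV
  have hkey := PEP_eval f d hdeg hd x V hx hV
  have hinj := (hplan x⁻¹ (inv_ne_zero hx)).1
  have hv : x⁻¹ * V = 0 := by
    apply hinj
    simp only [zero_add, mul_zero, add_zero]
    rw [add_comm (x⁻¹ * V) x⁻¹]
    linear_combination hkey + (aeval (x⁻¹ * V) f - aeval 0 f) * hL2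
  exact mul_ne_zero (inv_ne_zero hx) hV0 hv

theorem exceptional_planar_even_deg
    (n d : ℕ) (hn : 0 < n)
    (K : Type) [Field K] [Fintype K] (hK : Fintype.card K = 2 ^ n)
    (f : K[X]) (hdeg : f.natDegree = d) (hexc : IsExceptionalPlanarEven f) :
    d = 1 ∨ d = 2 ∨ 4 ∣ d := by
  by_contra hcon
  have : Fact (Nat.Prime 2) := ⟨Nat.prime_two⟩
  have : CharP K 2 := charP_of_card_eq_prime_pow hK
  have h2 : (2 : K) = 0 := CharTwo.two_eq_zero
  have had : f.coeff d ≠ 0 := by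
    have : f ≠ 0 := by rintro rfl; simp at hdeg; omega
    rw [← hdeg]
    exact leadingCoeff_ne_zero.2 this
  have hodd_cast : ∀ k : ℕ, k % 2 = 1 → (k : K) = 1 := by
    intro k hk
    rw [← Nat.div_add_mod k 2, hk]
    push_cast
    rw [h2]; ring
  have hev_cast : ∀ k : ℕ, k % 2 = 0 → (k : K) = 0 := by
    intro k hk
    rw [← Nat.div_add_mod k 2, hk]
    push_cast
    rw [h2]; ring
  have hlead : ∀ t, ((PEP f d).coeff t).eval 0 = ((PEP f d).map (evalRingHom 0)).coeff t := by
    intro t; rw [coeff_map]; rfl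
  have hd : 3 ≤ d := by omega
  rcases Nat.mod_two_eq_zero_or_one d with hpar | hpar
  · obtain ⟨k, hk⟩ : ∃ k, d = 4 * k + 2 := ⟨d / 4, by omega⟩
    have hch : ((d.choose 2 : ℕ) : K) = 1 := by
      apply hodd_cast
      have : d.choose 2 = 2 * (4 * k ^ 2 + 3 * k) + 1 := by
        rw [Nat.choose_two_right, hk]
        apply Nat.div_eq_of_eq_mul_left two_pos
        rw [show 4 * k + 2 - 1 = 4 * k + 1 by omega]
        ring
      omega
    refine PE_final K f d hdeg hd hexc (d - 3) (by omega) ?_ ?_ 0 ?_ ?_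
    · intro t ht
      rcases Nat.lt_or_ge (d - 2) t with h | h
      · exact PEP_coeff_zero f d t hd (by omega)
      · rw [PEP_coeff_pred f d t hd (by omega), hev_cast d hpar]; simp
    · rw [hlead, PEP_map f d hd, coeff_C_mul, PEq_coeff, if_neg (by omega),
        show d - 3 + 1 = d - 2 by omega, Nat.choose_symm (by omega), hch]
      simpa using had
    · rw [← coeff_zero_eq_eval_zero, PEq_coeff, if_neg (by omega)]
      simp [hev_cast d hpar]
    · rw [← coeff_zero_eq_eval_zero, coeff_derivative, PEq_coeff, if_neg (by omega)]
      simp [hch]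
  · have hX := PEq_mul_X K d
    rw [if_neg (by omega)] at hX
    refine PE_final K f d hdeg hd hexc (d - 2) (by omega) ?_ ?_ 1 ?_ ?_
    · intro t ht
      exact PEP_coeff_zero f d t hd (by omega)
    · rw [PEP_coeff_pred f d (d - 2) hd (by omega), hodd_cast d hpar]
      simpa using had
    · have := congrArg (eval 1) hX
      simp only [eval_mul, eval_X, mul_one, eval_sub, eval_pow, eval_add, eval_one, one_pow] at this
      rw [this, one_add_one_eq_two, h2, zero_pow (by omega)]
      linear_combination -h2
    · have e0 := congrArg (eval 1) hX
      have := congrArg (fun p => eval 1 (derivative p)) hX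
      simp only [eval_mul, eval_X, mul_one, eval_sub, eval_pow, eval_add, eval_one, one_pow,
        derivative_mul, derivative_X, derivative_sub, derivative_one, derivative_pow,
        derivative_add, eval_natCast, zero_add, sub_zero, map_natCast] at this e0
      rw [e0, one_add_one_eq_two, h2, zero_pow (by omega), zero_pow (by omega), hodd_cast d hpar] at this
      intro h
      rw [h] at this
      apply one_ne_zero (α := K)
      linear_combination -this
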